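/- Let β > 1 be an Ito–Sadahiro number with preperiod m ≥ 0 and period p ≥ 1, let d_1 d_2 d_3 … be the (−β)-digit sequence of l_β, let P be the Ito–Sadahiro polynomial of β, and write T_j = T^j(l_β) for j ≥ 0. Then P(x) = (x − β)·Q(x) as polynomials with real coefficients, where Q(x) = −(−x)^{m+p−1} + Σ_{i=m}^{m+p−2}(T_{m+p−1−i} − T_0 − 1)·(−x)^i + Σ_{i=0}^{m−1}(T_{m+p−1−i} − T_{m−1−i})·(−x)^i. -/

import Mathlib

/-- `l_β = -β/(β+1)` -/
noncomputable def ISl (β : ℝ) : ℝ := -β / (β + 1)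

/-- The Ito–Sadahiro transformation `T(x) = -βx - ⌊-βx - l_β⌋`. -/
noncomputable def IST (β : ℝ) (x : ℝ) : ℝ := -β * x - ⌊-β * x - ISl β⌋

/-- The `i`-th `(-β)`-digit of `x` (for `i ≥ 1`): `x_i = ⌊-β T^{i-1}(x) - l_β⌋`. -/
noncomputable def ISdigit (β x : ℝ) (i : ℕ) : ℤ := ⌊-β * (IST β)^[i - 1] x - ISl β⌋

theorem IST_mem_Ico (β x : ℝ) : IST β x ∈ Set.Ico (ISl β) (ISl β + 1) := by
  have h₁ := Int.floor_le (-β * x - ISl β)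
  have h₂ := Int.lt_floor_add_one (-β * x - ISl β)
  unfold IST
  constructor <;> linarith

theorem iterate_IST_ISl_mem_Ico (β : ℝ) (j : ℕ) :
    (IST β)^[j] (ISl β) ∈ Set.Ico (ISl β) (ISl β + 1) := by
  cases j with
  | zero => simp
  | succ j =>
    rw [Function.iterate_succ_apply']
    exact IST_mem_Ico _ _

theorem iterate_IST_succ (β x : ℝ) (j : ℕ) :
    (IST β)^[j + 1] x = -β * (IST β)^[j] x - ISdigit β x (j + 1) := by
  rw [Function.iterate_succ_apply', ISdigit, IST, Nat.add_sub_cancel]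

/-- Since `T` expands differences by `-β` as long as digits agree, an orbit with eventually
periodic digits is itself eventually periodic. -/
theorem iterate_IST_ISl_eq_of_digits_periodic {β : ℝ} (hβ : 1 < β) {m p : ℕ}
    (hper : ∀ i : ℕ, m < i → ISdigit β (ISl β) (i + p) = ISdigit β (ISl β) i) :
    (IST β)^[m + p] (ISl β) = (IST β)^[m] (ISl β) := by
  have hdiff (k : ℕ) : (IST β)^[m + k + p] (ISl β) - (IST β)^[m + k] (ISl β)
      = (-β) ^ k * ((IST β)^[m + p] (ISl β) - (IST β)^[m] (ISl β)) := by
    induction k with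
    | zero => simp
    | succ k ih =>
      have hd := hper (m + k + 1) (by omega)
      rw [show m + k + 1 + p = m + k + p + 1 by omega] at hd
      rw [show m + (k + 1) + p = m + k + p + 1 by omega, ← add_assoc m k 1,
        iterate_IST_succ, iterate_IST_succ, hd, pow_succ]
      linear_combination (-β) * ih
  by_contra hne
  have hpos : 0 < |(IST β)^[m + p] (ISl β) - (IST β)^[m] (ISl β)| :=
    abs_pos.mpr (sub_ne_zero.mpr hne)
  obtain ⟨k, hk⟩ := pow_unbounded_of_one_lt
    (1 / |(IST β)^[m + p] (ISl β) - (IST β)^[m] (ISl β)|) hβ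
  rw [div_lt_iff₀ hpos] at hk
  have habs := congrArg abs (hdiff k)
  rw [abs_mul, abs_pow, abs_neg, abs_of_pos (by linarith : 0 < β)] at habs
  have h₁ := iterate_IST_ISl_mem_Ico β (m + k + p)
  have h₂ := iterate_IST_ISl_mem_Ico β (m + k)
  have hlt : |(IST β)^[m + k + p] (ISl β) - (IST β)^[m + k] (ISl β)| < 1 :=
    abs_lt.mpr ⟨by linarith [h₁.1, h₂.2], by linarith [h₁.2, h₂.1]⟩
  linarith

/-- The polynomial `∑_{j<n} T_{k+n-1-j} y^j` whose coefficients are the `n` consecutive terms of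
`T` starting at `T_k`, in decreasing order of degree. -/
def segmentSum (T : ℕ → ℝ) (y : ℝ) (k n : ℕ) : ℝ :=
  ∑ j ∈ Finset.range n, T (k + n - 1 - j) * y ^ j

theorem segmentSum_succ (T : ℕ → ℝ) (y : ℝ) (k n : ℕ) :
    segmentSum T y k (n + 1) = y * segmentSum T y k n + T (k + n) := by
  rw [segmentSum, Finset.sum_range_succ', segmentSum, Finset.mul_sum]
  congr 1
  · refine Finset.sum_congr rfl fun j _ => ?_
    rw [show k + (n + 1) - 1 - (j + 1) = k + n - 1 - j by omega]
    ring
  · simp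

theorem segmentSum_zero_add (T : ℕ → ℝ) (y : ℝ) (k n : ℕ) :
    segmentSum T y 0 (k + n) = y ^ n * segmentSum T y 0 k + segmentSum T y k n := by
  induction n with
  | zero => simp [segmentSum]
  | succ n ih =>
    rw [← add_assoc, segmentSum_succ, segmentSum_succ, ih, zero_add]
    ring

theorem sum_digits_eq_segmentSum {β : ℝ} {T : ℕ → ℝ} {d : ℕ → ℤ}
    (hrec : ∀ j, T (j + 1) = -β * T j - d (j + 1)) (y : ℝ) (k n : ℕ) :
    ∑ i ∈ Finset.Icc (k + 1) (k + n), (d i : ℝ) * y ^ (k + n - i)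
      = -(β + y) * segmentSum T y k n - T (k + n) + T k * y ^ n := by
  induction n with
  | zero => simp [segmentSum]
  | succ n ih =>
    have hstep : ∑ i ∈ Finset.Icc (k + 1) (k + n), (d i : ℝ) * y ^ (k + n + 1 - i)
        = y * ∑ i ∈ Finset.Icc (k + 1) (k + n), (d i : ℝ) * y ^ (k + n - i) := by
      rw [Finset.mul_sum]
      refine Finset.sum_congr rfl fun i hi => ?_
      rw [Nat.succ_sub (Finset.mem_Icc.mp hi).2, pow_succ]
      ring
    rw [← add_assoc, Finset.sum_Icc_succ_top (by omega), hstep, ih, segmentSum_succ, hrec,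
      Nat.sub_self]
    ring

/-- The factorization `P(x) = (x - β) Q(x)` of the Ito–Sadahiro polynomial, where
`Q(x) = -(-x)^{m+p-1} + ∑_{i=m}^{m+p-2}(T_{m+p-1-i} - T_0 - 1)(-x)^i
        + ∑_{i=0}^{m-1}(T_{m+p-1-i} - T_{m-1-i})(-x)^i`,
with `T_j = T^j(l_β)`.  (The first sum in `Q` is indexed by `i = m + j`, `0 ≤ j ≤ p - 2`,
to avoid truncated subtraction in the bounds.) -/
theorem ito_sadahiro_polynomial_factorization (β : ℝ) (hβ : 1 < β) (m p : ℕ) (hp : 1 ≤ p)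
    (hper : ∀ i : ℕ, m < i → ISdigit β (ISl β) (i + p) = ISdigit β (ISl β) i)
    (d : ℕ → ℤ) (hd : ∀ i : ℕ, 1 ≤ i → d i = ISdigit β (ISl β) i)
    (T : ℕ → ℝ) (hT : ∀ j : ℕ, T j = (IST β)^[j] (ISl β)) :
    ∀ x : ℝ,
      (-x) ^ (m + 1) * (∑ i ∈ Finset.range p, (-x) ^ i)
          + ((-x) ^ p - 1) * (∑ i ∈ Finset.Icc 1 m, (d i : ℝ) * (-x) ^ (m - i))
          + (∑ i ∈ Finset.Icc (m + 1) (m + p), (d i : ℝ) * (-x) ^ (m + p - i))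
        = (x - β) *
          (-(-x) ^ (m + p - 1)
            + (∑ j ∈ Finset.range (p - 1), (T (p - 1 - j) - T 0 - 1) * (-x) ^ (m + j))
            + (∑ i ∈ Finset.range m, (T (m + p - 1 - i) - T (m - 1 - i)) * (-x) ^ i)) := by
  intro x
  obtain ⟨y, rfl⟩ : ∃ y, x = -y := ⟨-x, by ring⟩
  rw [neg_neg]
  have hrec (j : ℕ) : T (j + 1) = -β * T j - d (j + 1) := by
    rw [hT, hT, hd _ (by omega), iterate_IST_succ]
  have hTper : T (m + p) = T m := by
    rw [hT, hT, iterate_IST_ISl_eq_of_digits_periodic hβ hper]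
  have hT0 : T 0 * (β + 1) = -β := by
    rw [hT, Function.iterate_zero_apply, ISl]
    exact div_mul_cancel₀ _ (by linarith)
  have hDm := sum_digits_eq_segmentSum hrec y 0 m
  simp only [zero_add] at hDm
  have hupper : -y ^ (m + p - 1)
      + ∑ j ∈ Finset.range (p - 1), (T (p - 1 - j) - T 0 - 1) * y ^ (m + j)
      = y ^ m * (segmentSum T y 0 p - (T 0 + 1) * ∑ i ∈ Finset.range p, y ^ i) := by
    obtain ⟨q, rfl⟩ : ∃ q, p = q + 1 := ⟨p - 1, by omega⟩
    simp only [segmentSum, zero_add, Nat.add_sub_cancel]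
    rw [Finset.mul_sum, ← Finset.sum_sub_distrib, Finset.mul_sum, Finset.sum_range_succ,
      Nat.sub_self, ← add_assoc, Nat.add_sub_cancel, add_comm]
    congr 1
    · exact Finset.sum_congr rfl fun j _ => by ring
    · ring
  have hlower : ∑ i ∈ Finset.range m, (T (m + p - 1 - i) - T (m - 1 - i)) * y ^ i
      = segmentSum T y p m - segmentSum T y 0 m := by
    simp only [segmentSum, sub_mul, Finset.sum_sub_distrib, zero_add, add_comm m p]
  have hconcat : y ^ m * segmentSum T y 0 p + segmentSum T y p m
      = y ^ p * segmentSum T y 0 m + segmentSum T y m p := by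
    rw [← segmentSum_zero_add, ← segmentSum_zero_add, add_comm]
  rw [hDm, sum_digits_eq_segmentSum hrec, hTper, hupper, hlower]
  linear_combination (β + y) * hconcat - T 0 * y ^ m * geom_sum_mul y p
    - y ^ m * (∑ i ∈ Finset.range p, y ^ i) * hT0
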